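/- For all sufficiently large w, for every M sufficiently large in terms of w, and for every n ≥ 1, there exist L = ⌊w³/30⌋ sets X₁, X₂, …, X_L ⊆ [M]^n, each of the form X_i = A_{i,1} × A_{i,2} × ⋯ × A_{i,n} with A_{i,j} ⊆ [M] and |A_{i,j}| = w for all j (so |X₁| = ⋯ = |X_L| = w^n < M^n), such that E(X₁) < E(X₂) < ⋯ < E(X_L) and E(X_{i+1})/E(X_i) ≤ 1 + 360/w³ for every 1 ≤ i < L. -/

import Mathlib

/-- The additive energy of a finite set `A`: the number of quadruples
`(a₁, a₂, a₃, a₄) ∈ A⁴` with `a₁ + a₂ = a₃ + a₄`. -/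
def addEnergy {α : Type*} [DecidableEq α] [Add α] (A : Finset α) : ℕ :=
  (((A ×ˢ A) ×ˢ A ×ˢ A).filter fun p => p.1.1 + p.1.2 = p.2.1 + p.2.2).card

/-- The number of solutions of `z + b = c + d` with `b, c, d ∈ B`. -/
def relCount (B : Finset ℤ) (z : ℤ) : ℕ :=
  ∑ b ∈ B, ∑ c ∈ B, ∑ d ∈ B, if z + b = c + d then 1 else 0

lemma addEnergy_eq_sum {α : Type*} [DecidableEq α] [Add α] (A : Finset α) :
    addEnergy A = ∑ a ∈ A, ∑ b ∈ A, ∑ c ∈ A, ∑ d ∈ A, if a + b = c + d then 1 else 0 := by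
  rw [addEnergy, Finset.card_filter, Finset.sum_product, Finset.sum_product]
  simp_rw [Finset.sum_product]

/-- Adjoining a new maximum `z` to `B` creates only the trivial quadruples and those coming from
the relations `z + b = c + d` in `B`. -/
lemma addEnergy_insert {B : Finset ℤ} {z : ℤ} (hz : ∀ b ∈ B, b < z) :
    addEnergy (insert z B) = addEnergy B + 4 * B.card + 1 + 4 * relCount B z := by
  have hzB : z ∉ B := fun h => lt_irrefl z (hz z h)
  have two_left : ∑ c ∈ B, ∑ d ∈ B, (if z + z = c + d then 1 else 0) = 0 := by
    refine Finset.sum_eq_zero fun c hc => Finset.sum_eq_zero fun d hd => if_neg ?_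
    have := hz c hc
    have := hz d hd
    omega
  have two_right : ∑ a ∈ B, ∑ b ∈ B, (if a + b = z + z then 1 else 0) = 0 := by
    simpa only [eq_comm] using two_left
  have three : ∑ d ∈ B, (if z = d then 1 else 0) = 0 := by
    rw [Finset.sum_ite_eq, if_neg hzB]
  have three' : ∑ d ∈ B, (if d = z then 1 else 0) = 0 := by
    rw [Finset.sum_ite_eq', if_neg hzB]
  have diag : ∑ b ∈ B, ∑ d ∈ B, (if b = d then 1 else 0) = B.card := by
    rw [Finset.card_eq_sum_ones]
    refine Finset.sum_congr rfl fun b hb => ?_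
    rw [Finset.sum_ite_eq, if_pos hb]
  have left_rel : ∑ b ∈ B, ∑ c ∈ B, ∑ d ∈ B, (if z + b = c + d then 1 else 0) = relCount B z := rfl
  have right_rel : ∑ a ∈ B, ∑ b ∈ B, ∑ d ∈ B, (if a + b = z + d then 1 else 0) = relCount B z := by
    symm
    rw [relCount, Finset.sum_comm]
    refine Finset.sum_congr rfl fun c _ => ?_
    rw [Finset.sum_comm]
    simp only [eq_comm]
  simp only [addEnergy_eq_sum]
  simp only [Finset.sum_insert hzB, Finset.sum_add_distrib]
  simp only [add_right_inj, add_comm _ z, three, three', diag]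
  simp only [two_left, two_right, left_rel, right_rel, if_true]
  ring

lemma addEnergy_piFinset {n : ℕ} (A : Fin n → Finset ℤ) :
    addEnergy (Fintype.piFinset A) = ∏ j, addEnergy (A j) := by
  simp only [addEnergy]
  rw [← Fintype.card_piFinset]
  refine Finset.card_nbij'
    (fun p j => ((p.1.1 j, p.1.2 j), (p.2.1 j, p.2.2 j)))
    (fun q => ((fun j => (q j).1.1, fun j => (q j).1.2), (fun j => (q j).2.1, fun j => (q j).2.2)))
    ?_ ?_ ?_ ?_
  · rintro ⟨⟨a, b⟩, c, d⟩ h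
    simp only [Finset.coe_filter, Finset.mem_product, Fintype.mem_piFinset, Set.mem_ofPred_eq,
      Finset.mem_coe, Finset.mem_filter, funext_iff, Pi.add_apply] at h ⊢
    exact fun j => ⟨⟨⟨h.1.1.1 j, h.1.1.2 j⟩, h.1.2.1 j, h.1.2.2 j⟩, h.2 j⟩
  · intro q h
    simp only [Finset.coe_filter, Finset.mem_product, Fintype.mem_piFinset, Set.mem_ofPred_eq,
      Finset.mem_coe, Finset.mem_filter, funext_iff, Pi.add_apply] at h ⊢
    exact ⟨⟨⟨fun j => (h j).1.1.1, fun j => (h j).1.1.2⟩, fun j => (h j).1.2.1,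
      fun j => (h j).1.2.2⟩, fun j => (h j).2⟩
  · intro p _; rfl
  · intro q _; rfl

lemma relCount_eq_zero {B : Finset ℤ} {T z : ℤ} (hB : B ⊆ Finset.Icc 1 T) (hz : 2 * T ≤ z) :
    relCount B z = 0 := by
  refine Finset.sum_eq_zero fun b hb => Finset.sum_eq_zero fun c hc =>
    Finset.sum_eq_zero fun d hd => if_neg ?_
  have := Finset.mem_Icc.1 (hB hb)
  have := Finset.mem_Icc.1 (hB hc)
  have := Finset.mem_Icc.1 (hB hd)
  omega

lemma relCount_eq_sum_card (B : Finset ℤ) (z : ℤ) :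
    relCount B z = ∑ b ∈ B, (B.filter fun c => z + b - c ∈ B).card := by
  refine Finset.sum_congr rfl fun b _ => ?_
  rw [Finset.card_filter]
  refine Finset.sum_congr rfl fun c _ => ?_
  rw [← Finset.sum_ite_eq B (z + b - c) fun _ => 1]
  refine Finset.sum_congr rfl fun d _ => ?_
  congr 1
  exact propext ⟨fun h => by omega, fun h => by omega⟩

lemma relCount_Icc {m k : ℕ} (hk : k ≤ m) :
    relCount (Finset.Icc 1 (m : ℤ)) (2 * m - k) = (k + 1).choose 2 := by
  have count : ∀ i ∈ Finset.range m, ((Finset.Icc 1 (m : ℤ)).filter fun c =>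
      (2 * m - k : ℤ) + ((i : ℤ) + 1) - c ∈ Finset.Icc 1 (m : ℤ)).card = k - i := by
    intro i hi
    have : ((Finset.Icc 1 (m : ℤ)).filter fun c =>
        (2 * m - k : ℤ) + ((i : ℤ) + 1) - c ∈ Finset.Icc 1 (m : ℤ)) =
        Finset.Icc ((m : ℤ) - k + i + 1) m := by
      ext c
      simp only [Finset.mem_filter, Finset.mem_Icc]
      omega
    rw [this, Int.card_Icc]
    omega
  have reindex : Finset.Icc 1 (m : ℤ) =
      (Finset.range m).map (Nat.castEmbedding.trans (addRightEmbedding 1)) := by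
    ext c
    simp only [Finset.mem_Icc, Finset.mem_map, Finset.mem_range, Function.Embedding.trans_apply,
      Nat.castEmbedding_apply, addRightEmbedding_apply]
    exact ⟨fun h => ⟨(c - 1).toNat, by omega, by omega⟩, by rintro ⟨i, hi, rfl⟩; omega⟩
  rw [relCount_eq_sum_card]
  nth_rewrite 1 [reindex]
  rw [Finset.sum_map]
  refine (Finset.sum_congr rfl count).trans ?_
  rw [← Finset.sum_subset (Finset.range_subset_range.2 hk) fun i _ hi => by
      simp only [Finset.mem_range] at hi; omega,
    Nat.choose_two_right, ← Finset.sum_range_id (k + 1), ← Finset.sum_range_reflect,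
    Finset.sum_range_succ' _ k, add_zero]
  refine Finset.sum_congr rfl fun i hi => ?_
  have := Finset.mem_range.1 hi
  omega

/-- The relations created by `y + d` after adjoining a far point `y`. -/
lemma relCount_insert_far {C : Finset ℤ} {T y d : ℤ} (hC : C ⊆ Finset.Icc 1 T) (hd : 1 ≤ d)
    (hdT : d ≤ T) (hy : 2 * T < y) :
    relCount (insert y C) (y + d) = 2 * (C.filter fun b => b + d ∈ C).card := by
  have hyC : y ∉ C := fun h => by
    have := Finset.mem_Icc.1 (hC h)
    omega
  have shifted : ∀ b ∈ C, ((insert y C).filter fun c => y + d + b - c ∈ insert y C).card =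
      if b + d ∈ C then 2 else 0 := by
    intro b hb
    have := Finset.mem_Icc.1 (hC hb)
    split_ifs with h
    · have e : (insert y C).filter (fun c => y + d + b - c ∈ insert y C) = {y, b + d} := by
        ext c
        simp only [Finset.mem_filter, Finset.mem_insert, Finset.mem_singleton]
        constructor
        · rintro ⟨rfl | hc, h' | h'⟩
          · omega
          · exact Or.inl rfl
          · right; omega
          · have := Finset.mem_Icc.1 (hC hc)
            have := Finset.mem_Icc.1 (hC h')
            omega
        · rintro (rfl | rfl)
          · exact ⟨Or.inl rfl, Or.inr (by convert h using 1; ring)⟩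
          · exact ⟨Or.inr h, Or.inl (by ring)⟩
      rw [e, Finset.card_pair]
      omega
    · rw [Finset.card_eq_zero, Finset.filter_eq_empty_iff]
      simp only [Finset.mem_insert, not_or]
      rintro c (rfl | hc)
      · exact ⟨by omega, fun h' => h (by convert h' using 1; ring)⟩
      · have := Finset.mem_Icc.1 (hC hc)
        refine ⟨fun h' => h ?_, fun h' => ?_⟩
        · convert hc using 1; omega
        · have := Finset.mem_Icc.1 (hC h')
          omega
  rw [relCount_eq_sum_card, Finset.sum_insert hyC, Finset.sum_congr rfl shifted,
    ← Finset.sum_filter, Finset.sum_const, smul_eq_mul, mul_comm 2, Nat.add_eq_right,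
    Finset.card_eq_zero, Finset.filter_eq_empty_iff]
  intro c hc h
  have bound : ∀ u ∈ insert y C, u ≤ y := fun u hu => by
    rcases Finset.mem_insert.1 hu with rfl | hu
    · exact le_rfl
    · have := Finset.mem_Icc.1 (hC hu)
      omega
  have := bound c hc
  have := bound _ h
  omega

/-- The initial interval `[1, m]` has energy `4 (m choose 3)` above the minimal one. -/
lemma addEnergy_Icc (m : ℕ) :
    addEnergy (Finset.Icc 1 (m : ℤ)) + m = 2 * m ^ 2 + 4 * m.choose 3 := by
  induction m with
  | zero => simp [addEnergy]
  | succ m ih =>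
    have hins : Finset.Icc 1 ((m + 1 : ℕ) : ℤ) = insert ((m : ℤ) + 1) (Finset.Icc 1 (m : ℤ)) := by
      ext c
      simp only [Finset.mem_Icc, Finset.mem_insert]
      omega
    rw [hins, addEnergy_insert fun b hb => by have := Finset.mem_Icc.1 hb; omega, Int.card_Icc]
    rcases m with _ | m
    · simp [relCount, addEnergy, Nat.choose]
    have := relCount_Icc (m := m + 1) (k := m) (by omega)
    rw [show 2 * ((m + 1 : ℕ) : ℤ) - m = ((m + 1 : ℕ) : ℤ) + 1 by push_cast; ring] at this
    rw [this, Nat.choose_succ_succ' (m + 1) 2]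
    have h : ((m + 1 : ℕ) + 1 - 1 : ℤ).toNat = m + 1 := by omega
    rw [h]
    nlinarith

/-- Dissociated points can be adjoined without changing the excess of the energy over its
minimum. -/
lemma exists_generic_extension {B : Finset ℤ} {T e : ℕ} (hT : 1 ≤ T)
    (hB : B ⊆ Finset.Icc 1 (T : ℤ))
    (he : addEnergy B + B.card = 2 * B.card ^ 2 + e) (s : ℕ) :
    ∃ A : Finset ℤ, A ⊆ Finset.Icc 1 ((2 ^ s * T : ℕ) : ℤ) ∧ A.card = B.card + s ∧
      addEnergy A + A.card = 2 * A.card ^ 2 + e := by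
  induction s with
  | zero => exact ⟨B, by simpa using hB, rfl, he⟩
  | succ s ih =>
    obtain ⟨A, hA, hc, hE⟩ := ih
    set U : ℕ := 2 ^ s * T with hU
    have hU1 : 1 ≤ U := Nat.mul_pos (by positivity) hT
    have hU2 : 2 ^ (s + 1) * T = 2 * U := by rw [hU]; ring
    have hlt : ∀ b ∈ A, b < ((2 * U : ℕ) : ℤ) := fun b hb => by
      have := Finset.mem_Icc.1 (hA hb)
      omega
    have hcard : (insert ((2 * U : ℕ) : ℤ) A).card = A.card + 1 :=
      Finset.card_insert_of_notMem fun h => lt_irrefl _ (hlt _ h)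
    refine ⟨insert ((2 * U : ℕ) : ℤ) A, ?_, by omega, ?_⟩
    · rw [hU2]
      intro b hb
      rw [Finset.mem_Icc]
      rcases Finset.mem_insert.1 hb with rfl | hb
      · omega
      · have := Finset.mem_Icc.1 (hA hb)
        omega
    · rw [hcard, addEnergy_insert hlt, relCount_eq_zero hA (by push_cast; rfl)]
      nlinarith

/-- An interval, one outlier `2m - k`, and a far pair at distance `m + 1 - j`. -/
lemma exists_addEnergy_core {m k j : ℕ} (hk : k < m) (hj : 1 ≤ j) (hjk : j ≤ k + 1) :
    ∃ B : Finset ℤ, B ⊆ Finset.Icc 1 ((6 * m : ℕ) : ℤ) ∧ B.card = m + 3 ∧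
      addEnergy B + B.card = 2 * B.card ^ 2 + 4 * (m.choose 3 + (k + 1).choose 2 + 2 * j) := by
  set P := Finset.Icc 1 (m : ℤ) with hP
  set x : ℤ := 2 * m - k with hx
  set C := insert x P with hC
  set y : ℤ := 4 * m + 1 with hy
  set d : ℤ := m + 1 - j with hd
  have hPx : ∀ b ∈ P, b < x := fun b hb => by
    have := Finset.mem_Icc.1 hb
    omega
  have hCT : C ⊆ Finset.Icc 1 (2 * m : ℤ) := fun b hb => by
    rw [Finset.mem_Icc]
    rcases Finset.mem_insert.1 hb with rfl | hb
    · omega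
    · have := Finset.mem_Icc.1 hb
      omega
  have hCy : ∀ b ∈ C, b < y := fun b hb => by
    have := Finset.mem_Icc.1 (hCT hb)
    omega
  have hyd : ∀ b ∈ insert y C, b < y + d := fun b hb => by
    rcases Finset.mem_insert.1 hb with rfl | hb
    · omega
    · have := hCy b hb
      omega
  have hPcard : P.card = m := by rw [hP, Int.card_Icc]; omega
  have hCcard : C.card = m + 1 := by
    rw [hC, Finset.card_insert_of_notMem fun h => lt_irrefl _ (hPx _ h), hPcard]
  have hycard : (insert y C).card = m + 2 := by
    rw [Finset.card_insert_of_notMem fun h => lt_irrefl _ (hCy _ h), hCcard]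
  have hcard : (insert (y + d) (insert y C)).card = m + 3 := by
    rw [Finset.card_insert_of_notMem fun h => lt_irrefl _ (hyd _ h), hycard]
  have hrep : (C.filter fun b => b + d ∈ C).card = j := by
    have : C.filter (fun b => b + d ∈ C) =
        insert (x - d) (Finset.Icc 1 ((j : ℤ) - 1)) := by
      ext b
      simp only [hC, hP, Finset.mem_filter, Finset.mem_insert, Finset.mem_Icc]
      omega
    rw [this, Finset.card_insert_of_notMem, Int.card_Icc]
    · omega
    · rw [Finset.mem_Icc]
      omega
  refine ⟨insert (y + d) (insert y C), ?_, hcard, ?_⟩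
  · intro b hb
    rw [Finset.mem_Icc]
    rcases Finset.mem_insert.1 hb with rfl | hb
    · omega
    rcases Finset.mem_insert.1 hb with rfl | hb
    · omega
    · have := Finset.mem_Icc.1 (hCT hb)
      omega
  · have hE := addEnergy_Icc m
    rw [hcard, addEnergy_insert hyd, addEnergy_insert hCy, hC, addEnergy_insert hPx, ← hC,
      relCount_eq_zero hCT (by omega), relCount_insert_far hCT (by omega) (by omega) (by omega),
      relCount_Icc hk.le, hrep, hycard, hCcard, hPcard]
    nlinarith

lemma lt_add_choose (N r : ℕ) : N < (N + (r + 1)).choose (r + 1) := by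
  induction N with
  | zero => simp
  | succ N ih =>
    rw [show N + 1 + (r + 1) = N + (r + 1) + 1 by ring, Nat.choose_succ_succ']
    have : 0 < (N + (r + 1)).choose r := Nat.choose_pos (by omega)
    omega

lemma exists_le_lt_succ {f : ℕ → ℕ} {N : ℕ} (h0 : f 0 ≤ N) (h : ∃ n, N < f n) :
    ∃ n, f n ≤ N ∧ N < f (n + 1) := by
  classical
  have hpos : Nat.find h ≠ 0 := fun h' => by
    have := Nat.find_spec h
    rw [h'] at this
    omega
  refine ⟨Nat.find h - 1, ?_, ?_⟩
  · exact not_lt.1 (Nat.find_min h (by omega))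
  · rw [Nat.sub_add_cancel (by omega)]
    exact Nat.find_spec h

/-- Greedy expansion of a natural number in binomial coefficients. -/
lemma exists_binomial_expansion (q : ℕ) :
    ∃ m k t, k < m ∧ t ≤ k ∧ q = m.choose 3 + (k + 1).choose 2 + t := by
  obtain ⟨m, hm, hm'⟩ := exists_le_lt_succ (f := fun n => n.choose 3) (N := q) (by simp)
    ⟨_, lt_add_choose q 2⟩
  obtain ⟨k, hk, hk'⟩ := exists_le_lt_succ (f := fun n => (n + 1).choose 2)
    (N := q - m.choose 3) (by simp) ⟨_, lt_add_choose (q - m.choose 3) 1⟩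
  have pascal₃ : (m + 1).choose 3 = m.choose 2 + m.choose 3 := Nat.choose_succ_succ' m 2
  have pascal₂ : (k + 1 + 1).choose 2 = k + 1 + (k + 1).choose 2 := by
    rw [Nat.choose_succ_succ' (k + 1) 1, Nat.choose_one_right]
  refine ⟨m, k, q - m.choose 3 - (k + 1).choose 2, ?_, by omega, by omega⟩
  by_contra! h
  have := Nat.choose_le_choose 2 (show m ≤ k + 1 by omega)
  omega

/-- Energies of `w`-element sets are `8`-dense in the relevant range. -/
lemma exists_addEnergy_near {w v : ℕ} (hw : 100 ≤ w) (hv : 2 * w ^ 2 ≤ v)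
    (hv' : 45 * v ≤ 13 * w ^ 3 + 45) :
    ∃ A : Finset ℤ, A ⊆ Finset.Icc 1 ((2 ^ w * (6 * w) : ℕ) : ℤ) ∧ A.card = w ∧
      v < addEnergy A ∧ addEnergy A ≤ v + 8 := by
  obtain ⟨m, k, t, hkm, htk, hq⟩ := exists_binomial_expansion ((v + w - 2 * w ^ 2) / 4)
  have hmw : m + 3 ≤ w := by
    by_contra! h
    have h1 := Nat.choose_le_choose 3 (show w - 2 ≤ m by omega)
    obtain ⟨u, rfl⟩ : ∃ u, w = u + 4 := ⟨w - 4, by omega⟩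
    have h2 : (u + 4 - 2).choose 3 * 6 = (u + 2) * (u + 1) * u := by
      have := Nat.descFactorial_eq_factorial_mul_choose (u + 2) 3
      simp only [Nat.descFactorial_succ, Nat.descFactorial_zero, Nat.factorial,
        Nat.add_sub_cancel, Nat.sub_zero, show u + 2 - 1 = u + 1 by omega] at this
      rw [show u + 4 - 2 = u + 2 by omega]
      linarith
    have h3 : 4 * (u + 4 - 2).choose 3 ≤ v := by
      have : v + (u + 4) - 2 * (u + 4) ^ 2 ≤ v := by
        have : u + 4 ≤ 2 * (u + 4) ^ 2 := by nlinarith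
        omega
      omega
    obtain ⟨u, rfl⟩ : ∃ a, u = a + 96 := ⟨u - 96, by omega⟩
    ring_nf at h2 h3 hv'
    nlinarith [Nat.zero_le (u ^ 3), Nat.zero_le (u ^ 2)]
  obtain ⟨B, hB, hBc, hBE⟩ := exists_addEnergy_core hkm (j := t / 2 + 1) (by omega) (by omega)
  obtain ⟨A, hA, hAc, hAE⟩ :=
    exists_generic_extension (T := 6 * m) (by omega) hB hBE (w - (m + 3))
  have hAw : A.card = w := by omega
  refine ⟨A, hA.trans (Finset.Icc_subset_Icc le_rfl ?_), hAw, ?_, ?_⟩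
  · exact_mod_cast Nat.mul_le_mul (Nat.pow_le_pow_right (by norm_num) (by omega)) (by omega)
  · rw [hAw] at hAE
    omega
  · rw [hAw] at hAE
    omega

/-- A chain of `w`-element sets of integers with increasing energies and consecutive gaps at
most `8`. -/
lemma exists_addEnergy_chain {w : ℕ} (hw : 100 ≤ w) :
    ∃ S : ℕ → Finset ℤ, ∀ i < w ^ 3 / 30,
      S i ⊆ Finset.Icc 1 ((2 ^ w * (6 * w) : ℕ) : ℤ) ∧ (S i).card = w ∧
      w ^ 3 ≤ 45 * addEnergy (S i) ∧
      (i + 1 < w ^ 3 / 30 → addEnergy (S i) < addEnergy (S (i + 1)) ∧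
        addEnergy (S (i + 1)) ≤ addEnergy (S i) + 8) := by
  have hnear : ∀ v, ∃ A : Finset ℤ, 2 * w ^ 2 ≤ v → 45 * v ≤ 13 * w ^ 3 + 45 →
      A ⊆ Finset.Icc 1 ((2 ^ w * (6 * w) : ℕ) : ℤ) ∧ A.card = w ∧
      v < addEnergy A ∧ addEnergy A ≤ v + 8 := fun v => by
    by_cases h : 2 * w ^ 2 ≤ v ∧ 45 * v ≤ 13 * w ^ 3 + 45
    · obtain ⟨A, hA⟩ := exists_addEnergy_near hw h.1 h.2
      exact ⟨A, fun _ _ => hA⟩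
    · exact ⟨∅, fun h1 h2 => absurd ⟨h1, h2⟩ h⟩
  choose g hg using hnear
  set a := w ^ 3 / 45 + 1 with ha
  have haw : 2 * w ^ 2 ≤ a := by
    have : 100 * w ^ 2 ≤ w ^ 3 := by
      rw [pow_succ w 2, mul_comm]
      exact Nat.mul_le_mul_left _ hw
    omega
  let e : ℕ → ℕ := fun i => (fun v => addEnergy (g v))^[i] a
  have he : ∀ i, e (i + 1) = addEnergy (g (e i)) := fun i =>
    Function.iterate_succ_apply' _ _ _
  have hrange : ∀ i < w ^ 3 / 30, a ≤ e i ∧ e i ≤ a + 8 * i := fun i => by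
    induction i with
    | zero => exact fun _ => ⟨le_rfl, le_rfl⟩
    | succ i ih =>
      intro hi
      obtain ⟨h1, h2⟩ := ih (by omega)
      have := hg (e i) (by omega) (by omega)
      rw [he]
      omega
  have hstep : ∀ i < w ^ 3 / 30, g (e i) ⊆ Finset.Icc 1 ((2 ^ w * (6 * w) : ℕ) : ℤ) ∧
      (g (e i)).card = w ∧ e i < addEnergy (g (e i)) ∧ addEnergy (g (e i)) ≤ e i + 8 :=
    fun i hi => by
      obtain ⟨h1, h2⟩ := hrange i hi
      exact hg (e i) (by omega) (by omega)
  refine ⟨fun i => g (e i), fun i hi => ⟨(hstep i hi).1, (hstep i hi).2.1, ?_, fun hi' => ?_⟩⟩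
  · change w ^ 3 ≤ 45 * addEnergy (g (e i))
    have := hrange i hi
    have := hstep i hi
    omega
  · have := hstep (i + 1) hi'
    rw [he i] at this
    simp only [he]
    omega

/-- For all sufficiently large `w`, every `M` sufficiently large in terms of `w`, and every
`n ≥ 1`, there are `L = ⌊w³/30⌋` product sets `Xᵢ = A_{i,1} × ⋯ × A_{i,n} ⊆ [M]^n` with
`|A_{i,j}| = w` (so `|Xᵢ| = wⁿ < Mⁿ`), such that `E(X₁) < ⋯ < E(X_L)` and
`E(X_{i+1})/E(Xᵢ) ≤ 1 + 360/w³` for every `1 ≤ i < L`. -/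
theorem energy_dense_chain :
    ∃ W₀ : ℕ, ∀ w : ℕ, W₀ ≤ w → ∃ M₀ : ℕ, ∀ M : ℕ, M₀ ≤ M → ∀ n : ℕ, 1 ≤ n →
      ∃ A : ℕ → ℕ → Finset ℤ,
        (∀ i, 1 ≤ i → i ≤ w ^ 3 / 30 → ∀ j, 1 ≤ j → j ≤ n →
          A i j ⊆ Finset.Icc 1 (M : ℤ) ∧ (A i j).card = w) ∧
        (∀ i, 1 ≤ i → i ≤ w ^ 3 / 30 →
          (Fintype.piFinset fun j : Fin n => A i (j.1 + 1)).card = w ^ n ∧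
            w ^ n < M ^ n) ∧
        (∀ i, 1 ≤ i → i + 1 ≤ w ^ 3 / 30 →
          addEnergy (Fintype.piFinset fun j : Fin n => A i (j.1 + 1)) <
              addEnergy (Fintype.piFinset fun j : Fin n => A (i + 1) (j.1 + 1)) ∧
            (addEnergy (Fintype.piFinset fun j : Fin n => A (i + 1) (j.1 + 1)) : ℝ) /
                addEnergy (Fintype.piFinset fun j : Fin n => A i (j.1 + 1)) ≤
              1 + 360 / (w : ℝ) ^ 3) := by
  refine ⟨100, fun w hw => ⟨2 ^ w * (6 * w), fun M hM n hn => ?_⟩⟩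
  obtain ⟨S, hS⟩ := exists_addEnergy_chain hw
  have hwM : w < M := by
    have : 1 ≤ 2 ^ w := Nat.one_le_two_pow
    nlinarith
  have hw3 : 0 < w ^ 3 / 30 := by
    have : 100 ^ 3 ≤ w ^ 3 := Nat.pow_le_pow_left hw 3
    omega
  have hmem : ∀ i < w ^ 3 / 30, S i ⊆ Finset.Icc 1 (M : ℤ) ∧ (S i).card = w := fun i hi =>
    ⟨(hS i hi).1.trans (Finset.Icc_subset_Icc le_rfl (by exact_mod_cast hM)), (hS i hi).2.1⟩
  set A : ℕ → ℕ → Finset ℤ := fun i j => if j = 1 then S (i - 1) else S 0 with hA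
  have hAmem : ∀ i, 1 ≤ i → i ≤ w ^ 3 / 30 → ∀ j,
      A i j ⊆ Finset.Icc 1 (M : ℤ) ∧ (A i j).card = w := fun i h1 hi j => by
    simp only [hA]
    split_ifs
    · exact hmem _ (by omega)
    · exact hmem _ hw3
  obtain ⟨n, rfl⟩ : ∃ n', n = n' + 1 := ⟨n - 1, by omega⟩
  have hE : ∀ i, addEnergy (Fintype.piFinset fun j : Fin (n + 1) => A i (j.1 + 1)) =
      addEnergy (S (i - 1)) * addEnergy (S 0) ^ n := fun i => by
    rw [addEnergy_piFinset, Fin.prod_univ_succ]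
    simp [hA]
  have hpos : ∀ i < w ^ 3 / 30, 0 < addEnergy (S i) := fun i hi => by
    have := (hS i hi).2.2.1
    omega
  refine ⟨A, fun i h1 hi j _ _ => hAmem i h1 hi j, fun i h1 hi => ⟨?_, ?_⟩, fun i h1 hi => ?_⟩
  · rw [Fintype.card_piFinset]
    simp [(hAmem i h1 hi _).2]
  · exact Nat.pow_lt_pow_left hwM (by omega)
  · obtain ⟨i, rfl⟩ : ∃ i', i = i' + 1 := ⟨i - 1, by omega⟩
    obtain ⟨-, -, hlow, hnext⟩ := hS i (by omega)
    obtain ⟨hlt, hle⟩ := hnext (by omega)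
    have h0 := hpos 0 hw3
    have hi0 := hpos i (by omega)
    simp only [hE, Nat.add_sub_cancel]
    refine ⟨Nat.mul_lt_mul_of_pos_right hlt (by positivity), ?_⟩
    push_cast
    rw [mul_div_mul_right _ _ (by positivity), div_le_iff₀ (by positivity)]
    have hw0 : (0 : ℝ) < (w : ℝ) ^ 3 := by
      have : 0 < w := by omega
      positivity
    have hle' : (addEnergy (S (i + 1)) : ℝ) ≤ addEnergy (S i) + 8 := by exact_mod_cast hle
    have hlow' : (w : ℝ) ^ 3 ≤ 45 * addEnergy (S i) := by exact_mod_cast hlow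
    have : 8 ≤ 360 / (w : ℝ) ^ 3 * addEnergy (S i) := by
      rw [div_mul_eq_mul_div, le_div_iff₀ hw0]
      linarith
    linarith
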